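/- arXiv:2512.18526 — 2 statements merged into one kernel-verified Lean document; each statement's English description precedes it below -/
import Mathlib

section
/- Measure-and-prepare (mixture) form of read-only access: let W be any read-only protocol map (a finite composition of conjugations by the extended U-QRAM unitary Ũ and S-local Kraus steps with Σ_i K_iᴴ K_i = I), and fix any matrix ρ_S on ℂ^S. For each truth table m : Fin N → Bool let σ_m = Tr_M(W(ρ_S ⊗ |m⟩⟨m|)), where |m⟩⟨m| is the matrix on ℂ^M with a single 1 in entry (m,m). Then for every matrix ρ_M on ℂ^M, Tr_M(W(ρ_S ⊗ ρ_M)) = Σ_m ρ_M(m,m) · σ_m. Hence the induced memory-to-output map ρ_M ↦ Tr_M(W(ρ_S ⊗ ρ_M)) is a measure-and-prepare (classical-to-quantum) channel determined by the diagonal entries ρ_M(m,m). -/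
open Matrix

/-- The U-QRAM read unitary: the permutation matrix on `ℂ^(A × D × M)` induced by the
bijection `(a, y, m) ↦ (a, y XOR m a, m)`. -/
noncomputable def uqramU (n : ℕ) :
    Matrix (Fin (2^n) × Bool × (Fin (2^n) → Bool))
      (Fin (2^n) × Bool × (Fin (2^n) → Bool)) ℂ :=
  fun r c => if r = (c.1, xor c.2.1 (c.2.2 c.1), c.2.2) then 1 else 0

/-- The extended U-QRAM unitary `Ũ` on `ℂ^(S × M)` with `S = A × D × R`: it acts as `U`
on the `A × D × M` factors and as the identity on the ancilla `R`. -/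
noncomputable def uqramUtilde (n : ℕ) (R : Type) [DecidableEq R] :
    Matrix ((Fin (2^n) × Bool × R) × (Fin (2^n) → Bool))
      ((Fin (2^n) × Bool × R) × (Fin (2^n) → Bool)) ℂ :=
  fun p q =>
    if p.1.2.2 = q.1.2.2 then
      uqramU n (p.1.1, p.1.2.1, p.2) (q.1.1, q.1.2.1, q.2)
    else 0

/-- The Kronecker product `K ⊗ I_M` of a matrix `K` on `ℂ^S` with the identity on the
memory. -/
def krausExt {S : Type} {N : ℕ} (K : Matrix S S ℂ) :
    Matrix (S × (Fin N → Bool)) (S × (Fin N → Bool)) ℂ :=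
  fun p q => if p.2 = q.2 then K p.1 q.1 else 0

/-- The Kronecker product of a matrix on `ℂ^S` with a matrix on `ℂ^M`, indexed by
`S × M`. -/
def kron {S M : Type} (A : Matrix S S ℂ) (B : Matrix M M ℂ) :
    Matrix (S × M) (S × M) ℂ :=
  fun p q => A p.1 q.1 * B p.2 q.2

/-- Dephasing (pinching) in the truth-table basis on the memory: keep the diagonal
entries of `ρ_M` and zero the off-diagonal ones. -/
def deph {N : ℕ} (ρM : Matrix (Fin N → Bool) (Fin N → Bool) ℂ) :
    Matrix (Fin N → Bool) (Fin N → Bool) ℂ :=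
  fun m m' => if m = m' then ρM m m' else 0

/-- The partial trace over the memory of a matrix indexed by `S × M`:
`(Tr_M X)(s, s') = Σ_m X((s,m),(s',m))`. -/
noncomputable def ptraceMem {S : Type} {N : ℕ}
    (X : Matrix (S × (Fin N → Bool)) (S × (Fin N → Bool)) ℂ) :
    Matrix S S ℂ :=
  fun s s' => ∑ m : Fin N → Bool, X (s, m) (s', m)

/-- A read-only protocol map on matrices indexed by `S × M` (with `S = A × D × R`):
a finite composition of (i) conjugations `X ↦ Ũ X Ũᴴ` by the extended U-QRAM unitary and
(ii) S-local Kraus steps `X ↦ Σ_i (K_i ⊗ I_M) X (K_i ⊗ I_M)ᴴ` with `Σ_i K_iᴴ K_i = I`. -/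
inductive IsReadOnly (n : ℕ) (R : Type) [Fintype R] [DecidableEq R] :
    (Matrix ((Fin (2^n) × Bool × R) × (Fin (2^n) → Bool))
        ((Fin (2^n) × Bool × R) × (Fin (2^n) → Bool)) ℂ →
      Matrix ((Fin (2^n) × Bool × R) × (Fin (2^n) → Bool))
        ((Fin (2^n) × Bool × R) × (Fin (2^n) → Bool)) ℂ) → Prop
  | id : IsReadOnly n R id
  | read (W) (hW : IsReadOnly n R W) :
      IsReadOnly n R (fun X => uqramUtilde n R * W X * (uqramUtilde n R)ᴴ)
  | kraus (ι : Type) [Fintype ι]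
      (K : ι → Matrix (Fin (2^n) × Bool × R) (Fin (2^n) × Bool × R) ℂ)
      (hK : ∑ i, (K i)ᴴ * K i = 1) (W) (hW : IsReadOnly n R W) :
      IsReadOnly n R (fun X => ∑ i, krausExt (K i) * W X * (krausExt (K i))ᴴ)


/-- The rank-one matrix `|m⟩⟨m|` on `ℂ^M`, with a single `1` in entry `(m, m)`. -/
def ketbra {N : ℕ} (m : Fin N → Bool) :
    Matrix (Fin N → Bool) (Fin N → Bool) ℂ :=
  fun x y => if x = m ∧ y = m then 1 else 0

/-- A matrix on `ℂ^(S × M)` is block diagonal in the memory basis. -/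
def MemBlockDiagonal {S M : Type} (B : Matrix (S × M) (S × M) ℂ) : Prop :=
  ∀ p q, p.2 ≠ q.2 → B p q = 0

lemma memBlockDiagonal_uqramUtilde (n : ℕ) (R : Type) [DecidableEq R] :
    MemBlockDiagonal (uqramUtilde n R) := by
  intro p q h
  simp [uqramUtilde, uqramU, h]

lemma memBlockDiagonal_krausExt {S : Type} {N : ℕ} (K : Matrix S S ℂ) :
    MemBlockDiagonal (krausExt (N := N) K) :=
  fun _ _ h => if_neg h

/-- Conjugation by a memory-block-diagonal matrix acts on each diagonal memory block
separately. -/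
lemma MemBlockDiagonal.conj_apply {S M : Type} [Fintype S] [Fintype M]
    {B : Matrix (S × M) (S × M) ℂ} (hB : MemBlockDiagonal B)
    (X : Matrix (S × M) (S × M) ℂ) (m : M) (s s' : S) :
    (B * X * Bᴴ) (s, m) (s', m) =
      ∑ t, (∑ u, B (s, m) (u, m) * X (u, m) (t, m)) * star (B (s', m) (t, m)) := by
  have collapse (f : S × M → ℂ) (hf : ∀ p, p.2 ≠ m → f p = 0) :
      ∑ p, f p = ∑ t, f (t, m) := by
    rw [Fintype.sum_prod_type]
    exact Finset.sum_congr rfl fun t _ => Fintype.sum_eq_single m fun m' h => hf (t, m') h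
  rw [mul_apply, collapse _ fun p hp => by
    rw [conjTranspose_apply, hB _ _ (Ne.symm hp), star_zero, mul_zero]]
  refine Finset.sum_congr rfl fun t _ => ?_
  rw [mul_apply, conjTranspose_apply, collapse _ fun p hp => by
    rw [hB _ _ (Ne.symm hp), zero_mul]]

lemma MemBlockDiagonal.conj_apply_eq_mul {S M : Type} [Fintype S] [Fintype M]
    {B : Matrix (S × M) (S × M) ℂ} (hB : MemBlockDiagonal B)
    {X Y : Matrix (S × M) (S × M) ℂ} {m : M} {c : ℂ}
    (h : ∀ s s', X (s, m) (s', m) = c * Y (s, m) (s', m)) (s s' : S) :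
    (B * X * Bᴴ) (s, m) (s', m) = c * (B * Y * Bᴴ) (s, m) (s', m) := by
  simp only [hB.conj_apply, h, Finset.mul_sum, Finset.sum_mul]
  exact Finset.sum_congr rfl fun t _ => Finset.sum_congr rfl fun u _ => by ring

/-- A read-only protocol map sends proportional diagonal memory blocks to proportional
diagonal memory blocks, with the same factor. -/
lemma IsReadOnly.apply_eq_mul {n : ℕ} {R : Type} [Fintype R] [DecidableEq R]
    {W : Matrix ((Fin (2^n) × Bool × R) × (Fin (2^n) → Bool))
        ((Fin (2^n) × Bool × R) × (Fin (2^n) → Bool)) ℂ →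
      Matrix ((Fin (2^n) × Bool × R) × (Fin (2^n) → Bool))
        ((Fin (2^n) × Bool × R) × (Fin (2^n) → Bool)) ℂ}
    (hW : IsReadOnly n R W)
    {X Y : Matrix ((Fin (2^n) × Bool × R) × (Fin (2^n) → Bool))
        ((Fin (2^n) × Bool × R) × (Fin (2^n) → Bool)) ℂ}
    {m : Fin (2^n) → Bool} {c : ℂ}
    (h : ∀ s s', X (s, m) (s', m) = c * Y (s, m) (s', m)) :
    ∀ s s', W X (s, m) (s', m) = c * W Y (s, m) (s', m) := by
  induction hW with
  | id => exact h
  | read W _ ih => exact (memBlockDiagonal_uqramUtilde n R).conj_apply_eq_mul ih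
  | kraus ι K _ W _ ih =>
    intro _ _
    simp only [Matrix.sum_apply, Finset.mul_sum]
    exact Finset.sum_congr rfl fun i _ =>
      (memBlockDiagonal_krausExt (K i)).conj_apply_eq_mul ih _ _

/-- measure-and-prepare (mixture) form of read-only access.  For any
read-only protocol map `W` and fixed accessible input `ρ_S`, the induced output is the
mixture `Σ_m ρ_M(m,m) • σ_m` where `σ_m = Tr_M(W(ρ_S ⊗ |m⟩⟨m|))`; hence the induced
memory-to-output map is a measure-and-prepare channel determined by the diagonal of
`ρ_M`. -/
theorem readonly_measure_and_prepare (n : ℕ) (R : Type) [Fintype R] [DecidableEq R]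
    (W : Matrix ((Fin (2^n) × Bool × R) × (Fin (2^n) → Bool))
        ((Fin (2^n) × Bool × R) × (Fin (2^n) → Bool)) ℂ →
      Matrix ((Fin (2^n) × Bool × R) × (Fin (2^n) → Bool))
        ((Fin (2^n) × Bool × R) × (Fin (2^n) → Bool)) ℂ)
    (hW : IsReadOnly n R W)
    (ρS : Matrix (Fin (2^n) × Bool × R) (Fin (2^n) × Bool × R) ℂ)
    (ρM : Matrix (Fin (2^n) → Bool) (Fin (2^n) → Bool) ℂ) :
    ptraceMem (W (kron ρS ρM)) =
      ∑ m : Fin (2^n) → Bool, ρM m m • ptraceMem (W (kron ρS (ketbra m))) := by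
  ext s s'
  have off_block (m m' : Fin (2^n) → Bool) (hm : m' ≠ m) :
      W (kron ρS (ketbra m)) (s, m') (s', m') = 0 := by
    have h := hW.apply_eq_mul (X := kron ρS (ketbra m)) (Y := 0) (m := m') (c := 0)
      (fun t t' => by simp [kron, ketbra, hm]) s s'
    rwa [zero_mul] at h
  simp only [Matrix.sum_apply, Matrix.smul_apply, smul_eq_mul, ptraceMem]
  refine Finset.sum_congr rfl fun m _ => ?_
  rw [Fintype.sum_eq_single m (off_block m)]
  exact hW.apply_eq_mul (fun t t' => by simp [kron, ketbra, mul_comm]) s s'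
end

section
/- Opacity with a reference system: let Q be a finite reference type and let W be any read-only protocol map extended to act on matrices indexed by (S × M) × Q as W ⊗ id_Q (each step acts as before on the S × M factors and as the identity on Q). Then for every matrix ρ_S on ℂ^S and every matrix ρ_{MQ} on ℂ^(M×Q), Tr_M((W ⊗ id_Q)(ρ_S ⊗ ρ_{MQ})) = Tr_M((W ⊗ id_Q)(ρ_S ⊗ (D ⊗ id_Q)(ρ_{MQ}))), where (D ⊗ id_Q)(ρ_{MQ})((m,q),(m',q')) equals ρ_{MQ}((m,q),(m',q')) if m = m' and 0 otherwise, and Tr_M is the partial trace over M (the output being a matrix on ℂ^(S×Q)). Thus only the truth-table-diagonal blocks of ρ_{MQ} can influence read-only observables, even given side information Q. -/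
open Matrix

/-- The extension `T ⊗ I_Q` of a matrix `T` on `ℂ^A` by the identity on a reference
system `Q`. -/
def refExt {A Q : Type} [DecidableEq Q] (T : Matrix A A ℂ) :
    Matrix (A × Q) (A × Q) ℂ :=
  fun p q => if p.2 = q.2 then T p.1 q.1 else 0

/-- A single step of a read-only protocol: either a read (conjugation by the extended
U-QRAM unitary `Ũ`) or an S-local Kraus step given by a finite family of matrices on
`ℂ^S`. -/
inductive Step (n : ℕ) (R : Type) : Type
  | read : Step n R
  | kraus (k : ℕ)
      (K : Fin k → Matrix (Fin (2^n) × Bool × R) (Fin (2^n) × Bool × R) ℂ) : Step n R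

/-- Validity of a step: Kraus steps must satisfy the normalization `Σ_i K_iᴴ K_i = I`. -/
def Step.Valid {n : ℕ} {R : Type} [Fintype R] [DecidableEq R] : Step n R → Prop
  | .read => True
  | .kraus _ K => ∑ i, (K i)ᴴ * K i = 1

/-- The action of a step on matrices indexed by `(S × M) × Q`, acting as before on the
`S × M` factors and as the identity on the reference `Q`. -/
noncomputable def Step.actQ {n : ℕ} {R : Type} [Fintype R] [DecidableEq R]
    (Q : Type) [Fintype Q] [DecidableEq Q] :
    Step n R →
      Matrix ((((Fin (2^n) × Bool × R) × (Fin (2^n) → Bool))) × Q)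
          ((((Fin (2^n) × Bool × R) × (Fin (2^n) → Bool))) × Q) ℂ →
      Matrix ((((Fin (2^n) × Bool × R) × (Fin (2^n) → Bool))) × Q)
          ((((Fin (2^n) × Bool × R) × (Fin (2^n) → Bool))) × Q) ℂ
  | .read => fun X =>
      refExt (uqramUtilde n R) * X * (refExt (uqramUtilde n R))ᴴ
  | .kraus _ K => fun X =>
      ∑ i, refExt (krausExt (K i)) * X * (refExt (krausExt (K i)))ᴴ

/-- The extended action `W ⊗ id_Q` of a read-only protocol (a finite list of steps) on
matrices indexed by `(S × M) × Q`. -/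
noncomputable def protocolActQ {n : ℕ} {R : Type} [Fintype R] [DecidableEq R]
    (Q : Type) [Fintype Q] [DecidableEq Q] (L : List (Step n R)) :
    Matrix ((((Fin (2^n) × Bool × R) × (Fin (2^n) → Bool))) × Q)
        ((((Fin (2^n) × Bool × R) × (Fin (2^n) → Bool))) × Q) ℂ →
    Matrix ((((Fin (2^n) × Bool × R) × (Fin (2^n) → Bool))) × Q)
        ((((Fin (2^n) × Bool × R) × (Fin (2^n) → Bool))) × Q) ℂ :=
  L.foldr (fun st f => st.actQ Q ∘ f) id

/-- The joint input `ρ_S ⊗ ρ_{MQ}` as a matrix indexed by `(S × M) × Q`. -/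
def kronSMQ {S Q : Type} {N : ℕ} (ρS : Matrix S S ℂ)
    (ρMQ : Matrix ((Fin N → Bool) × Q) ((Fin N → Bool) × Q) ℂ) :
    Matrix ((S × (Fin N → Bool)) × Q) ((S × (Fin N → Bool)) × Q) ℂ :=
  fun p q => ρS p.1.1 q.1.1 * ρMQ (p.1.2, p.2) (q.1.2, q.2)

/-- The dephasing `(D ⊗ id_Q)` of the memory component of a matrix on `ℂ^(M × Q)`:
it keeps the truth-table-diagonal blocks and zeroes the others. -/
def dephQ {Q : Type} {N : ℕ}
    (ρMQ : Matrix ((Fin N → Bool) × Q) ((Fin N → Bool) × Q) ℂ) :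
    Matrix ((Fin N → Bool) × Q) ((Fin N → Bool) × Q) ℂ :=
  fun p q => if p.1 = q.1 then ρMQ p q else 0

/-- The partial trace over the memory of a matrix indexed by `(S × M) × Q`, yielding a
matrix on `ℂ^(S × Q)`. -/
noncomputable def ptraceMemQ {S Q : Type} {N : ℕ}
    (X : Matrix ((S × (Fin N → Bool)) × Q) ((S × (Fin N → Bool)) × Q) ℂ) :
    Matrix (S × Q) (S × Q) ℂ :=
  fun p q => ∑ m : Fin N → Bool, X ((p.1, m), p.2) ((q.1, m), q.2)

/-- Two matrices indexed by `(S × M) × Q` have the same memory-diagonal blocks. -/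
def MemDiagEq {S M Q : Type} (X Y : Matrix ((S × M) × Q) ((S × M) × Q) ℂ) : Prop :=
  ∀ p q, p.1.2 = q.1.2 → X p q = Y p q

/-- A matrix indexed by `(S × M) × Q` that is block diagonal in the memory. -/
def MemBlockDiag {S M Q : Type} (T : Matrix ((S × M) × Q) ((S × M) × Q) ℂ) : Prop :=
  ∀ p q, p.1.2 ≠ q.1.2 → T p q = 0

theorem MemDiagEq.conj {S M Q : Type} [Fintype S] [Fintype M] [Fintype Q]
    {X Y T : Matrix ((S × M) × Q) ((S × M) × Q) ℂ}
    (h : MemDiagEq X Y) (hT : MemBlockDiag T) :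
    MemDiagEq (T * X * Tᴴ) (T * Y * Tᴴ) := by
  intro p q hpq
  simp only [Matrix.mul_apply, Matrix.conjTranspose_apply]
  refine Finset.sum_congr rfl fun b _ => ?_
  by_cases hb : q.1.2 = b.1.2
  · congr 1
    refine Finset.sum_congr rfl fun a _ => ?_
    by_cases ha : p.1.2 = a.1.2
    · rw [h a b (ha.symm.trans (hpq.trans hb))]
    · rw [hT p a ha, zero_mul, zero_mul]
  · rw [hT q b hb, star_zero, mul_zero, mul_zero]

theorem memBlockDiag_refExt {S M Q : Type} [DecidableEq Q]
    {T : Matrix (S × M) (S × M) ℂ} (hT : ∀ p q, p.2 ≠ q.2 → T p q = 0) :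
    MemBlockDiag (refExt T : Matrix ((S × M) × Q) ((S × M) × Q) ℂ) := by
  intro p q hpq
  simp [refExt, hT _ _ hpq]

theorem uqramUtilde_apply_of_mem_ne {n : ℕ} {R : Type} [DecidableEq R]
    (p q : (Fin (2^n) × Bool × R) × (Fin (2^n) → Bool)) (hpq : p.2 ≠ q.2) :
    uqramUtilde n R p q = 0 := by
  simp [uqramUtilde, uqramU, hpq]

theorem krausExt_apply_of_mem_ne {S : Type} {N : ℕ} (K : Matrix S S ℂ)
    (p q : S × (Fin N → Bool)) (hpq : p.2 ≠ q.2) : krausExt K p q = 0 :=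
  if_neg hpq

theorem MemDiagEq.actQ {n : ℕ} {R Q : Type} [Fintype R] [DecidableEq R]
    [Fintype Q] [DecidableEq Q]
    {X Y : Matrix (((Fin (2^n) × Bool × R) × (Fin (2^n) → Bool)) × Q)
      (((Fin (2^n) × Bool × R) × (Fin (2^n) → Bool)) × Q) ℂ}
    (h : MemDiagEq X Y) (st : Step n R) : MemDiagEq (st.actQ Q X) (st.actQ Q Y) := by
  cases st with
  | read => exact h.conj (memBlockDiag_refExt uqramUtilde_apply_of_mem_ne)
  | kraus k K =>
    intro p q hpq
    simp only [Step.actQ, Matrix.sum_apply]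
    exact Finset.sum_congr rfl fun i _ =>
      h.conj (memBlockDiag_refExt (krausExt_apply_of_mem_ne (K i))) p q hpq

theorem MemDiagEq.protocolActQ {n : ℕ} {R Q : Type} [Fintype R] [DecidableEq R]
    [Fintype Q] [DecidableEq Q]
    {X Y : Matrix (((Fin (2^n) × Bool × R) × (Fin (2^n) → Bool)) × Q)
      (((Fin (2^n) × Bool × R) × (Fin (2^n) → Bool)) × Q) ℂ}
    (h : MemDiagEq X Y) (L : List (Step n R)) :
    MemDiagEq (protocolActQ Q L X) (protocolActQ Q L Y) := by
  induction L with
  | nil => exact h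
  | cons st L ih => exact ih.actQ st

theorem memDiagEq_kronSMQ_dephQ {S Q : Type} {N : ℕ} (ρS : Matrix S S ℂ)
    (ρMQ : Matrix ((Fin N → Bool) × Q) ((Fin N → Bool) × Q) ℂ) :
    MemDiagEq (kronSMQ ρS ρMQ) (kronSMQ ρS (dephQ ρMQ)) := by
  intro p q hpq
  simp [kronSMQ, dephQ, hpq]

theorem MemDiagEq.ptraceMemQ_eq {S Q : Type} {N : ℕ}
    {X Y : Matrix ((S × (Fin N → Bool)) × Q) ((S × (Fin N → Bool)) × Q) ℂ}
    (h : MemDiagEq X Y) : ptraceMemQ X = ptraceMemQ Y := by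
  ext p q
  exact Finset.sum_congr rfl fun m _ => h _ _ rfl

/-- opacity with a reference system.  For any read-only protocol map
extended as `W ⊗ id_Q`, the output partial trace over the memory is unchanged if the
joint memory–reference state `ρ_{MQ}` is replaced by its truth-table dephasing
`(D ⊗ id_Q)(ρ_{MQ})`: only the truth-table-diagonal blocks of `ρ_{MQ}` can influence
read-only observables, even given side information `Q`. -/
theorem readonly_opacity_with_reference (n : ℕ) (R : Type) [Fintype R] [DecidableEq R]
    (Q : Type) [Fintype Q] [DecidableEq Q]
    (L : List (Step n R)) (hL : ∀ st ∈ L, st.Valid)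
    (ρS : Matrix (Fin (2^n) × Bool × R) (Fin (2^n) × Bool × R) ℂ)
    (ρMQ : Matrix ((Fin (2^n) → Bool) × Q) ((Fin (2^n) → Bool) × Q) ℂ) :
    ptraceMemQ (protocolActQ Q L (kronSMQ ρS ρMQ)) =
      ptraceMemQ (protocolActQ Q L (kronSMQ ρS (dephQ ρMQ))) := by
  exact ((memDiagEq_kronSMQ_dephQ ρS ρMQ).protocolActQ L).ptraceMemQ_eq
end
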